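/- Let r' be a run of Dwork and Moses' optimum full-information SBA protocol, which decides at round m' = min{t+1, n−1} − W(r'), and let r be the corresponding run of the SendWaste protocol, which decides at the first round m satisfying m ≥ min{t+1, n−1} − d_N(r,m). Then m' ≤ m ≤ m' + 1; that is, SendWaste decides at most one round later than Dwork and Moses' protocol. -/

import Mathlib

namespace SBA

/-- The set of values `{0,1}`; `false` plays the role of `0`, `true` of `1`. -/
abbrev Values := Bool

/-- Actions of an agent in the SBA problem: decide a value, or do nothing. -/
inductive Action where
  | decide (v : Values)
  | noop
deriving DecidableEq

/-- An adversary: `F m i j = false` means agent `i`'s round-`m` message to `j`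
is not delivered. -/
structure Adversary (n : ℕ) where
  F : ℕ → Fin n → Fin n → Bool

/-- Validity of an adversary for the crash failure model `Crash_t`:
crashes are permanent, an undelivered message means the sender has crashed,
and at most `t` agents are faulty. -/
def Adversary.Valid {n : ℕ} (A : Adversary n) (t : ℕ) : Prop :=
  (∀ m i, A.F m i i = false → ∀ m', m < m' → ∀ k, A.F m' i k = false) ∧
  (∀ m i j, A.F m i j = false → A.F m i i = false) ∧
  {i : Fin n | ∃ m j, A.F m i j = false}.ncard ≤ t

/-- An information exchange: local state types, message types, the special
`crashed` state, a (bijective) choice of initial state for each initial value,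
the message selection function `μ` and the state update function `δ`. -/
structure InfoExchange (n : ℕ) where
  L : Fin n → Type
  M : Fin n → Type
  crashSt : ∀ i, L i
  initSt : ∀ i, Values → L i
  initInj : ∀ i, Function.Injective (initSt i)
  μ : ∀ i, L i → Action → (Fin n → Option (M i))
  δ : ∀ i, L i → Adversary n → Action → ((j : Fin n) → Option (M j)) → L i

/-- A decision protocol for information exchange `E`: each agent maps its
local state to an action. -/
def DecProtocol {n : ℕ} (E : InfoExchange n) := ∀ i : Fin n, E.L i → Action

/-- A run: a (constant) environment state (the adversary) together with, for
each time, a local state for each agent. -/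
structure Run {n : ℕ} (E : InfoExchange n) where
  env : Adversary n
  st : ℕ → (i : Fin n) → E.L i

/-- The vector of messages received by agent `i` in round `k+1`. -/
def recvd {n : ℕ} (E : InfoExchange n) (P : DecProtocol E) (r : Run E) (k : ℕ)
    (i : Fin n) : (j : Fin n) → Option (E.M j) :=
  fun j => if r.env.F (k+1) j i = true
           then E.μ j (r.st k j) (P j (r.st k j)) i else none

/-- Agent `i` has not been crashed by the adversary up to (and including) round `m`. -/
def aliveAt {n : ℕ} (A : Adversary n) (m : ℕ) (i : Fin n) : Prop :=
  ∀ k ≤ m, A.F k i i = true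

instance {n : ℕ} (A : Adversary n) (m : ℕ) (i : Fin n) : Decidable (aliveAt A m i) := by
  unfold aliveAt; infer_instance

/-- `r` is a run generated by decision protocol `P` with information exchange `E`
in the crash failure context `Crash_t`. -/
def IsRun {n : ℕ} (E : InfoExchange n) (P : DecProtocol E) (t : ℕ) (r : Run E) : Prop :=
  r.env.Valid t ∧
  (∀ i, ∃ v, r.st 0 i = E.initSt i v) ∧
  ∀ k i, r.st (k+1) i =
    if aliveAt r.env (k+1) i
    then E.δ i (r.st k i) r.env (P i (r.st k i)) (recvd E P r k i)
    else E.crashSt i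

/-- The interpreted system `I_{P,E,Crash_t}`: the set of runs of `(P,E)` in `Crash_t`. -/
def Runs {n : ℕ} (E : InfoExchange n) (P : DecProtocol E) (t : ℕ) : Set (Run E) :=
  {r | IsRun E P t r}

/-- Agent `i` is nonfailed at the point `(r,m)`, i.e. `i ∈ N(r,m)`. -/
def Nonfailed {n : ℕ} (E : InfoExchange n) (r : Run E) (m : ℕ) (i : Fin n) : Prop :=
  r.st m i ≠ E.crashSt i

/-- (Semantic) formulas: predicates on points. -/
abbrev Form {n : ℕ} (E : InfoExchange n) := Run E → ℕ → Prop

/-- Knowledge: `K_i φ` holds at `(r,m)` iff `φ` holds at every point of the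
system `R` that is indistinguishable to agent `i` from `(r,m)`. -/
def Kn {n : ℕ} (E : InfoExchange n) (R : Set (Run E)) (i : Fin n) (φ : Form E) : Form E :=
  fun r m => ∀ r' ∈ R, ∀ m', r.st m i = r'.st m' i → φ r' m'

/-- `E_N φ`: every nonfailed agent knows `φ`. -/
def EvK {n : ℕ} (E : InfoExchange n) (R : Set (Run E)) (φ : Form E) : Form E :=
  fun r m => ∀ i, Nonfailed E r m i → Kn E R i φ r m

/-- Common knowledge among the nonfailed agents: `E_N^k φ` for all `k ≥ 1`. -/
def CK {n : ℕ} (E : InfoExchange n) (R : Set (Run E)) (φ : Form E) : Form E :=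
  fun r m => ∀ k : ℕ, (EvK E R)^[k+1] φ r m

/-- The atomic proposition `∃v`: some agent has initial value `v` in the run. -/
def ExistsVal {n : ℕ} (E : InfoExchange n) (v : Values) : Form E :=
  fun r _m => ∃ i, r.st 0 i = E.initSt i v

/-- Two runs (of possibly different information exchanges) correspond: same
adversary and the same initial values for all agents. -/
def Corresponds {n : ℕ} (E1 E2 : InfoExchange n) (r1 : Run E1) (r2 : Run E2) : Prop :=
  r1.env = r2.env ∧ ∀ i, ∃ v, r1.st 0 i = E1.initSt i v ∧ r2.st 0 i = E2.initSt i v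

/-- Agreement: nonfailed agents decide the same value. -/
def Agreement {n : ℕ} (E : InfoExchange n) (P : DecProtocol E) (t : ℕ) : Prop :=
  ∀ r ∈ Runs E P t, ∀ (m m' : ℕ) (i j : Fin n) (v v' : Values),
    Nonfailed E r m i → Nonfailed E r m' j →
    P i (r.st m i) = Action.decide v → P j (r.st m' j) = Action.decide v' → v = v'

/-- Validity: any value decided by a nonfailed agent is some agent's initial value. -/
def ValidityP {n : ℕ} (E : InfoExchange n) (P : DecProtocol E) (t : ℕ) : Prop :=
  ∀ r ∈ Runs E P t, ∀ (m : ℕ) (i : Fin n) (v : Values),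
    Nonfailed E r m i → P i (r.st m i) = Action.decide v →
    ∃ j, r.st 0 j = E.initSt j v

/-- Simultaneity: if a nonfailed agent decides in a round, every nonfailed agent
decides in that round. -/
def Simultaneity {n : ℕ} (E : InfoExchange n) (P : DecProtocol E) (t : ℕ) : Prop :=
  ∀ r ∈ Runs E P t, ∀ (m : ℕ) (i j : Fin n) (v : Values),
    Nonfailed E r m i → Nonfailed E r m j →
    P i (r.st m i) = Action.decide v → ∃ w, P j (r.st m j) = Action.decide w

/-- Termination: every agent eventually decides or fails. -/
def TerminationP {n : ℕ} (E : InfoExchange n) (P : DecProtocol E) (t : ℕ) : Prop :=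
  ∀ r ∈ Runs E P t, ∀ i : Fin n,
    (∃ m, ¬ Nonfailed E r m i) ∨ (∃ m v, P i (r.st m i) = Action.decide v)

/-- `(P,E)` is an SBA protocol in the crash failure context `Crash_t`. -/
def IsSBA {n : ℕ} (E : InfoExchange n) (P : DecProtocol E) (t : ℕ) : Prop :=
  Agreement E P t ∧ ValidityP E P t ∧ Simultaneity E P t ∧ TerminationP E P t

/-- `E` does not transmit information about actions. -/
def NoActionInfo {n : ℕ} (E : InfoExchange n) : Prop :=
  ∀ (i : Fin n) (s : E.L i) (a₁ a₂ : Action),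
    E.μ i s a₁ = E.μ i s a₂ ∧ ∀ A v, E.δ i s A a₁ v = E.δ i s A a₂ v

/-- The trivial decision protocol (used to form `I_E` for an information exchange
that does not transmit information about actions). -/
def noopProt {n : ℕ} (E : InfoExchange n) : DecProtocol E := fun _ _ => Action.noop

/-- The interpreted system `I_E` of an information exchange that does not
transmit information about actions. -/
def Sys {n : ℕ} (E : InfoExchange n) (t : ℕ) : Set (Run E) :=
  Runs E (noopProt E) t

end SBA
namespace SBA

/-! ### Comparing information exchanges -/

/-- `E1` stores at least as much information as `E2`. -/
def StoresAtLeast {n : ℕ} (E1 E2 : InfoExchange n) (t : ℕ) : Prop :=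
  ∀ (r1 r3 : Run E1) (r2 r4 : Run E2),
    r1 ∈ Sys E1 t → r3 ∈ Sys E1 t → r2 ∈ Sys E2 t → r4 ∈ Sys E2 t →
    Corresponds E1 E2 r1 r2 → Corresponds E1 E2 r3 r4 →
    ∀ (m : ℕ) (i : Fin n), r1.st m i = r3.st m i → r2.st m i = r4.st m i

/-- `(r',m)` is `N`-reachable from `(r,m)` in `k` steps within the system `R`. -/
def NReach {n : ℕ} (E : InfoExchange n) (R : Set (Run E)) (m : ℕ) :
    ℕ → Run E → Run E → Prop
  | 0, r, r' => r = r'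
  | k+1, r, r' => ∃ r'', r'' ∈ R ∧ NReach E R m k r r'' ∧
      ∃ i : Fin n, Nonfailed E r'' m i ∧ Nonfailed E r' m i ∧ r''.st m i = r'.st m i

/-! ### Propositions about the environment -/

/-- A proposition about the environment: its truth value depends only on the
adversary, the agents' initial values, and the time. -/
def EnvProp (n : ℕ) := Adversary n → (Fin n → Values) → ℕ → Prop

/-- Interpretation of a proposition about the environment at a point of a run. -/
def envSat {n : ℕ} (E : InfoExchange n) (φ : EnvProp n) : Form E :=
  fun r m => ∃ f : Fin n → Values, (∀ i, r.st 0 i = E.initSt i (f i)) ∧ φ r.env f m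

/-! ### The knowledge-based program and optimality -/

/-- `P` is an implementation of the knowledge-based program `P^OPT` with respect
to `E` in `Crash_t`: at every point, for every nonfailed agent, `P` selects the
action chosen by the rule
`if K_i(C_N(∃0)) then decide 0 else if K_i(C_N(∃1)) then decide 1 else noop`. -/
def ImplementsOPT {n : ℕ} (E : InfoExchange n) (P : DecProtocol E) (t : ℕ) : Prop :=
  ∀ r ∈ Runs E P t, ∀ (m : ℕ) (i : Fin n), Nonfailed E r m i →
    (Kn E (Runs E P t) i (CK E (Runs E P t) (ExistsVal E false)) r m →
        P i (r.st m i) = Action.decide false) ∧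
    (¬ Kn E (Runs E P t) i (CK E (Runs E P t) (ExistsVal E false)) r m →
      Kn E (Runs E P t) i (CK E (Runs E P t) (ExistsVal E true)) r m →
        P i (r.st m i) = Action.decide true) ∧
    (¬ Kn E (Runs E P t) i (CK E (Runs E P t) (ExistsVal E false)) r m →
     ¬ Kn E (Runs E P t) i (CK E (Runs E P t) (ExistsVal E true)) r m →
        P i (r.st m i) = Action.noop)

/-- Self-Agreement: if an agent decides `v` and later decides `v'`, then `v = v'`. -/
def SelfAgreement {n : ℕ} (E : InfoExchange n) (P : DecProtocol E) (t : ℕ) : Prop :=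
  ∀ r ∈ Runs E P t, ∀ (i : Fin n) (m m' : ℕ) (v v' : Values), m ≤ m' →
    P i (r.st m i) = Action.decide v → P i (r.st m' i) = Action.decide v' → v = v'

/-- `P ≤_E P'`: whenever `P` decides, `P'` decides (in corresponding runs). -/
def ProtLE {n : ℕ} (E : InfoExchange n) (t : ℕ) (P P' : DecProtocol E) : Prop :=
  ∀ (r r' : Run E), r ∈ Runs E P t → r' ∈ Runs E P' t → Corresponds E E r r' →
    ∀ (m : ℕ) (i : Fin n) (v : Values),
      P i (r.st m i) = Action.decide v → ∃ w, P' i (r'.st m i) = Action.decide w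

/-- `P` is an optimum SBA protocol with respect to `E` in `Crash_t`. -/
def OptimumSBA {n : ℕ} (E : InfoExchange n) (P : DecProtocol E) (t : ℕ) : Prop :=
  IsSBA E P t ∧ ∀ P' : DecProtocol E, IsSBA E P' t → ProtLE E t P' P

/-! ### Receiving messages, clean rounds -/

/-- Agent `i` receives a message from agent `k` in round `m` (`m ≥ 1`) of run `r`. -/
def ReceivesFrom {n : ℕ} (E : InfoExchange n) (P : DecProtocol E) (r : Run E)
    (m : ℕ) (k i : Fin n) : Prop :=
  recvd E P r (m-1) i k ≠ none

/-- Round `m` of run `r` is clean: any message received by some nonfailed agent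
is received by every nonfailed agent. -/
def CleanRound {n : ℕ} (E : InfoExchange n) (P : DecProtocol E) (r : Run E)
    (m : ℕ) : Prop :=
  ∀ i j k : Fin n, Nonfailed E r m i → Nonfailed E r m j →
    ReceivesFrom E P r m k i → ReceivesFrom E P r m k j

/-! ### Distributed knowledge, number of failures, waste -/

/-- Distributed knowledge among the nonfailed agents. -/
def DK {n : ℕ} (E : InfoExchange n) (R : Set (Run E)) (φ : Form E) : Form E :=
  fun r m => ∀ r' ∈ R, (∀ i, Nonfailed E r m i → r.st m i = r'.st m i) → φ r' m

/-- The number of agents that have failed by time `k`. -/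
def numFailed {n : ℕ} (A : Adversary n) (k : ℕ) : ℕ :=
  (Finset.univ.filter (fun i : Fin n => ∃ m' ≤ k, A.F m' i i = false)).card

/-- `#KF(r,k)`: the largest `ℓ ≤ t` such that it is distributed knowledge among
the nonfailed agents at `(r,k)` that `ℓ` agents have failed. -/
noncomputable def numKF {n : ℕ} (E : InfoExchange n) (R : Set (Run E)) (t : ℕ)
    (r : Run E) (k : ℕ) : ℕ :=
  sSup {ℓ | ℓ ≤ t ∧ DK E R (fun r' m' => ℓ ≤ numFailed r'.env m') r k}

/-- The waste `W(r) = max_{k ≥ 0} (#KF(r,k) − k)`. -/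
noncomputable def Waste {n : ℕ} (E : InfoExchange n) (R : Set (Run E)) (t : ℕ)
    (r : Run E) : ℕ :=
  sSup {d | ∃ k, d = numKF E R t r k - k}

/-! ### minimum of a set of values -/

/-- The minimum of a (nonempty) set of values, where `false < true`. -/
def minW (W : Finset Bool) : Bool := if false ∈ W then false else true

end SBA
namespace SBA

/-- Local states of the SendWaste information exchange `E^send`. -/
inductive SendState where
  | crashed
  | live (W : Finset Bool) (h : ℕ) (d : ℕ) (m : ℕ) (v : Bool)
deriving DecidableEq

/-- The `d` (waste estimate) component of a SendWaste local state. -/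
def SendState.dof : SendState → ℕ
  | .crashed => 0
  | .live _ _ d _ _ => d

/-- The SendWaste information exchange `E^send`. -/
def sendE (n : ℕ) : InfoExchange n where
  L := fun _ => SendState
  M := fun _ => Finset Bool × ℕ
  crashSt := fun _ => .crashed
  initSt := fun _ v => .live {v} 0 0 0 v
  initInj := by
    intro i v v' h
    injection h with h1 h2 h3 h4 h5
  μ := fun _ s _ => match s with
    | .crashed => fun _ => none
    | .live W _ d _ _ => fun _ => some (W, d)
  δ := fun _ s _ _ ms => match s with
    | .crashed => .crashed
    | .live W _ d m v =>
        let h' := (Finset.univ.filter (fun j => (ms j).isNone)).card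
        let W' := W ∪ Finset.univ.biUnion (fun j => ((ms j).map Prod.fst).getD ∅)
        let dr := Finset.univ.sup (fun j => ((ms j).map Prod.snd).getD 0)
        .live W' h' (max (max d dr) (h' - (m+1))) (m+1) v

/-- `d_N(r,m)`: the maximum of the waste estimates of the nonfailed agents. -/
noncomputable def dN {n : ℕ} (r : Run (sendE n)) (m : ℕ) : ℕ :=
  letI : ∀ j : Fin n, Decidable (Nonfailed (sendE n) r m j) :=
    fun j => Classical.propDecidable _
  (Finset.univ.filter (fun j : Fin n => Nonfailed (sendE n) r m j)).sup
    (fun j => SendState.dof (r.st m j))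

end SBA
namespace SBA

/-- Local states of the full-information exchange: the initial value, together
with the full record of all messages (local states of other agents) received
in each round. -/
inductive FIPState (n : ℕ) where
  | crashed
  | start (v : Values)
  | node (prev : FIPState n) (msgs : Fin n → Option (FIPState n))

/-- The full-information exchange: each agent's initial state is its initial
value, in every round each noncrashed agent sends its entire local state to
every agent, and each agent records all messages it receives. -/
def FIP (n : ℕ) : InfoExchange n where
  L := fun _ => FIPState n
  M := fun _ => FIPState n
  crashSt := fun _ => .crashed
  initSt := fun _ v => .start v
  initInj := by
    intro i v v' h
    injection h
  μ := fun _ s _ => match s with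
    | .crashed => fun _ => none
    | s => fun _ => some s
  δ := fun _ s _ _ ms => match s with
    | .crashed => .crashed
    | s => .node s ms

end SBA
namespace SBA

/-! ### Crash failures -/

theorem Adversary.Valid.aliveAt_of_delivered {n t k : ℕ} {A : Adversary n} (hA : A.Valid t)
    {j i : Fin n} (h : A.F (k + 1) j i = true) : aliveAt A k j := by
  intro l hl
  by_contra hF
  have := hA.1 l j (by simpa using hF) (k + 1) (by omega) i
  simp [h] at this

theorem Adversary.Valid.exists_aliveAt {n t : ℕ} {A : Adversary n} (hA : A.Valid t)
    (ht : t < n) : ∃ i, ∀ k, aliveAt A k i := by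
  by_contra! hcon
  have huniv : {i : Fin n | ∃ m j, A.F m i j = false} = Set.univ := by
    ext i
    obtain ⟨k, hk⟩ := hcon i
    simp only [aliveAt, not_forall, Bool.not_eq_true] at hk
    obtain ⟨l, _, hl⟩ := hk
    simpa using ⟨l, i, hl⟩
  have hcard := hA.2.2
  rw [huniv, Set.ncard_univ, Nat.card_fin] at hcard
  omega

theorem Adversary.Valid.card_undelivered_le {n t : ℕ} {A : Adversary n} (hA : A.Valid t)
    (k : ℕ) (i : Fin n) : (Finset.univ.filter (fun j => A.F k j i = false)).card ≤ t := by
  refine le_trans ?_ hA.2.2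
  rw [← Set.ncard_coe_finset]
  refine Set.ncard_le_ncard ?_ (Set.toFinite _)
  intro j hj
  exact ⟨k, i, by simpa using hj⟩

theorem Adversary.Valid.numFailed_le_card_undelivered {n t : ℕ} {A : Adversary n}
    (hA : A.Valid t) (k : ℕ) (i : Fin n) :
    numFailed A k ≤ (Finset.univ.filter (fun j => A.F (k + 1) j i = false)).card := by
  refine Finset.card_le_card fun j hj => ?_
  simp only [Finset.mem_filter, Finset.mem_univ, true_and] at hj ⊢
  obtain ⟨l, hl, hF⟩ := hj
  exact hA.1 l j hF (k + 1) (by omega) i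

theorem Adversary.Valid.card_undelivered_le_numFailed {n t : ℕ} {A : Adversary n}
    (hA : A.Valid t) (k : ℕ) (i : Fin n) :
    (Finset.univ.filter (fun j => A.F k j i = false)).card ≤ numFailed A k := by
  refine Finset.card_le_card fun j hj => ?_
  simp only [Finset.mem_filter, Finset.mem_univ, true_and] at hj ⊢
  exact ⟨k, le_rfl, hA.2.1 k j i hj⟩

/-! ### The full-information exchange -/

theorem FIP_st_ne_crashed {n t : ℕ} {r : Run (FIP n)} (hr : r ∈ Sys (FIP n) t) {k : ℕ}
    {i : Fin n} (h : aliveAt r.env k i) : r.st k i ≠ FIPState.crashed := by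
  induction k with
  | zero =>
    obtain ⟨v, hv⟩ := hr.2.1 i
    rw [hv]
    exact fun h0 => by injection h0
  | succ k ih =>
    have hk := ih fun l hl => h l (by omega)
    rw [hr.2.2 k i, if_pos h]
    revert hk
    generalize r.st k i = s
    cases s with
    | crashed => exact fun hk => absurd rfl hk
    | start v => exact fun _ h0 => by injection h0
    | node p q => exact fun _ h0 => by injection h0

theorem FIP_st_succ {n t : ℕ} {r : Run (FIP n)} (hr : r ∈ Sys (FIP n) t) {k : ℕ}
    {i : Fin n} (h : aliveAt r.env (k + 1) i) :
    r.st (k + 1) i = FIPState.node (r.st k i) (recvd (FIP n) (noopProt (FIP n)) r k i) := by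
  have hk := FIP_st_ne_crashed hr (k := k) (i := i) fun l hl => h l (by omega)
  rw [hr.2.2 k i, if_pos h]
  revert hk
  generalize r.st k i = s
  cases s with
  | crashed => exact fun hk => absurd rfl hk
  | start v => exact fun _ => rfl
  | node p q => exact fun _ => rfl

theorem FIP_recvd_eq_none_iff {n t : ℕ} {r : Run (FIP n)} (hr : r ∈ Sys (FIP n) t) (k : ℕ)
    (i j : Fin n) :
    recvd (FIP n) (noopProt (FIP n)) r k i j = none ↔ r.env.F (k + 1) j i = false := by
  by_cases hF : r.env.F (k + 1) j i = true
  · have hk := FIP_st_ne_crashed hr (hr.1.aliveAt_of_delivered hF)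
    simp only [recvd, hF, if_true]
    revert hk
    generalize r.st k j = s
    cases s with
    | crashed => exact fun hk => absurd rfl hk
    | start v => exact fun _ => by simp [FIP]
    | node p q => exact fun _ => by simp [FIP]
  · simp [recvd, hF]

theorem bddAbove_numKF {n : ℕ} (E : InfoExchange n) (R : Set (Run E)) (t : ℕ) (r : Run E)
    (k : ℕ) :
    BddAbove {l | l ≤ t ∧ DK E R (fun r' m' => l ≤ numFailed r'.env m') r k} :=
  ⟨t, fun _ hl => hl.1⟩

theorem numKF_mem {n : ℕ} (E : InfoExchange n) (R : Set (Run E)) (t : ℕ) (r : Run E) (k : ℕ) :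
    numKF E R t r k ≤ t ∧
      DK E R (fun r' m' => numKF E R t r k ≤ numFailed r'.env m') r k :=
  Nat.sSup_mem (s := {l | l ≤ t ∧ DK E R (fun r' m' => l ≤ numFailed r'.env m') r k})
    ⟨0, Nat.zero_le _, fun _ _ _ => Nat.zero_le _⟩ (bddAbove_numKF E R t r k)

theorem numKF_le_numFailed {n t : ℕ} {E : InfoExchange n} {R : Set (Run E)} {r : Run E}
    (hr : r ∈ R) (k : ℕ) : numKF E R t r k ≤ numFailed r.env k :=
  (numKF_mem E R t r k).2 r hr fun _ _ => rfl

theorem bddAbove_waste {n : ℕ} (E : InfoExchange n) (R : Set (Run E)) (t : ℕ) (r : Run E) :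
    BddAbove {d | ∃ k, d = numKF E R t r k - k} := by
  refine ⟨t, ?_⟩
  rintro _ ⟨k, rfl⟩
  exact (Nat.sub_le _ _).trans (numKF_mem E R t r k).1

theorem numKF_sub_le_waste {n : ℕ} (E : InfoExchange n) (R : Set (Run E)) (t : ℕ) (r : Run E)
    (k : ℕ) : numKF E R t r k - k ≤ Waste E R t r :=
  le_csSup (bddAbove_waste E R t r) ⟨k, rfl⟩

theorem exists_waste_eq {n : ℕ} (E : InfoExchange n) (R : Set (Run E)) (t : ℕ) (r : Run E) :
    ∃ k, Waste E R t r = numKF E R t r k - k :=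
  Nat.sSup_mem (s := {d | ∃ k, d = numKF E R t r k - k}) ⟨_, 0, rfl⟩ (bddAbove_waste E R t r)

theorem card_undelivered_le_numKF {n t : ℕ} {r : Run (FIP n)} (hr : r ∈ Sys (FIP n) t)
    {k : ℕ} {i : Fin n} (h : aliveAt r.env (k + 1) i) :
    (Finset.univ.filter (fun j => r.env.F (k + 1) j i = false)).card ≤
      numKF (FIP n) (Sys (FIP n) t) t r (k + 1) := by
  refine le_csSup (bddAbove_numKF _ _ t r (k + 1)) ⟨hr.1.card_undelivered_le _ _, ?_⟩
  intro s hs hind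
  have hst := hind i (FIP_st_ne_crashed hr h)
  have hal : aliveAt s.env (k + 1) i := by
    by_contra hna
    rw [hs.2.2 k i, if_neg hna] at hst
    exact FIP_st_ne_crashed hr h hst
  rw [FIP_st_succ hr h, FIP_st_succ hs hal] at hst
  injection hst with _ hmsgs
  refine le_trans (le_of_eq ?_) (hs.1.card_undelivered_le_numFailed (k + 1) i)
  congr 1
  ext j
  simp only [Finset.mem_filter, Finset.mem_univ, true_and]
  rw [← FIP_recvd_eq_none_iff hr, ← FIP_recvd_eq_none_iff hs, hmsgs]

/-! ### The SendWaste exchange -/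

theorem sendE_st_eq_live {n t : ℕ} {r : Run (sendE n)} (hr : r ∈ Sys (sendE n) t) {k : ℕ}
    {i : Fin n} (h : aliveAt r.env k i) :
    ∃ W c d v, r.st k i = SendState.live W c d k v := by
  induction k with
  | zero =>
    obtain ⟨v, hv⟩ := hr.2.1 i
    exact ⟨{v}, 0, 0, v, hv⟩
  | succ k ih =>
    obtain ⟨W, c, d, v, hs⟩ := ih fun l hl => h l (by omega)
    rw [hr.2.2 k i, if_pos h, hs]
    exact ⟨_, _, _, _, rfl⟩

theorem sendE_recvd_isNone_iff {n t : ℕ} {r : Run (sendE n)} (hr : r ∈ Sys (sendE n) t)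
    (k : ℕ) (i j : Fin n) :
    (recvd (sendE n) (noopProt (sendE n)) r k i j).isNone = true ↔
      r.env.F (k + 1) j i = false := by
  by_cases hF : r.env.F (k + 1) j i = true
  · obtain ⟨W, c, d, v, hs⟩ := sendE_st_eq_live hr (hr.1.aliveAt_of_delivered hF)
    simp only [recvd, hF, if_true]
    rw [hs]
    simp [sendE]
  · simp [recvd, hF]

theorem sendE_dof_succ {n t : ℕ} {r : Run (sendE n)} (hr : r ∈ Sys (sendE n) t) {k : ℕ}
    {i : Fin n} (h : aliveAt r.env (k + 1) i) :
    SendState.dof (r.st (k + 1) i) =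
      max (max (SendState.dof (r.st k i)) (Finset.univ.sup fun j =>
          ((recvd (sendE n) (noopProt (sendE n)) r k i j).map Prod.snd).getD 0))
        ((Finset.univ.filter (fun j => r.env.F (k + 1) j i = false)).card - (k + 1)) := by
  obtain ⟨W, c, d, v, hs⟩ := sendE_st_eq_live hr (k := k) (i := i) fun l hl => h l (by omega)
  have hcard : Finset.univ.filter (fun j => r.env.F (k + 1) j i = false) = Finset.univ.filter
      (fun j => (recvd (sendE n) (noopProt (sendE n)) r k i j).isNone = true) :=
    Finset.filter_congr fun j _ => (sendE_recvd_isNone_iff hr k i j).symm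
  rw [hcard, hr.2.2 k i, if_pos h, hs]
  rfl

theorem sendE_recvd_snd_le {n : ℕ} (r : Run (sendE n)) (k : ℕ) (i j : Fin n) :
    ((recvd (sendE n) (noopProt (sendE n)) r k i j).map Prod.snd).getD 0 ≤
      SendState.dof (r.st k j) := by
  unfold recvd
  split_ifs
  · generalize r.st k j = s
    cases s with
    | crashed => exact le_rfl
    | live W c d m v => exact le_rfl
  · exact Nat.zero_le _

theorem sendE_dof_mono {n t : ℕ} {r : Run (sendE n)} (hr : r ∈ Sys (sendE n) t) {i : Fin n}
    (h : ∀ k, aliveAt r.env k i) : Monotone fun k => SendState.dof (r.st k i) := by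
  refine monotone_nat_of_le_succ fun k => ?_
  rw [sendE_dof_succ hr (h (k + 1))]
  exact (le_max_left _ _).trans (le_max_left _ _)

theorem sendE_dof_le_waste {n t : ℕ} {r : Run (sendE n)} (hr : r ∈ Sys (sendE n) t)
    {r' : Run (FIP n)} (hr' : r' ∈ Sys (FIP n) t) (henv : r.env = r'.env) (k : ℕ) (i : Fin n) :
    SendState.dof (r.st k i) ≤ Waste (FIP n) (Sys (FIP n) t) t r' := by
  induction k generalizing i with
  | zero =>
    obtain ⟨v, hv⟩ := hr.2.1 i
    rw [hv]
    exact Nat.zero_le _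
  | succ k ih =>
    by_cases h : aliveAt r.env (k + 1) i
    · rw [sendE_dof_succ hr h]
      refine max_le (max_le (ih i) (Finset.sup_le fun j _ =>
        (sendE_recvd_snd_le r k i j).trans (ih j))) ?_
      refine le_trans ?_ (numKF_sub_le_waste (FIP n) (Sys (FIP n) t) t r' (k + 1))
      rw [henv] at h ⊢
      exact Nat.sub_le_sub_right (card_undelivered_le_numKF hr' h) _
    · rw [hr.2.2 k i, if_neg h]
      exact Nat.zero_le _

theorem dN_le_waste {n t : ℕ} {r : Run (sendE n)} (hr : r ∈ Sys (sendE n) t)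
    {r' : Run (FIP n)} (hr' : r' ∈ Sys (FIP n) t) (henv : r.env = r'.env) (k : ℕ) :
    dN r k ≤ Waste (FIP n) (Sys (FIP n) t) t r' :=
  Finset.sup_le fun j _ => sendE_dof_le_waste hr hr' henv k j

theorem dof_le_dN {n t : ℕ} {r : Run (sendE n)} (hr : r ∈ Sys (sendE n) t) {k : ℕ}
    {i : Fin n} (h : aliveAt r.env k i) : SendState.dof (r.st k i) ≤ dN r k := by
  have hne : Nonfailed (sendE n) r k i := by
    obtain ⟨W, c, d, v, hs⟩ := sendE_st_eq_live hr h
    unfold Nonfailed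
    rw [hs]
    exact fun h0 => by injection h0
  unfold dN
  exact Finset.le_sup (f := fun j => SendState.dof (r.st k j)) (by simpa using hne)

theorem numFailed_sub_le_dN {n t : ℕ} (ht : t < n) {r : Run (sendE n)}
    (hr : r ∈ Sys (sendE n) t) {k l : ℕ} (hkl : k < l) :
    numFailed r.env k - (k + 1) ≤ dN r l := by
  obtain ⟨i, hi⟩ := hr.1.exists_aliveAt ht
  refine le_trans ?_ ((sendE_dof_mono hr hi (Nat.succ_le_of_lt hkl)).trans (dof_le_dN hr (hi l)))
  simp only [Nat.succ_eq_add_one]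
  rw [sendE_dof_succ hr (hi (k + 1))]
  exact (Nat.sub_le_sub_right (hr.1.numFailed_le_card_undelivered k i) _).trans (le_max_right _ _)

/-- let `r'` be a run of Dwork and Moses' optimum
full-information SBA protocol, which decides at round
`m' = min {t+1, n-1} − W(r')`, and let `r` be the corresponding run of
SendWaste, which decides at the first round `m` with
`m ≥ min {t+1, n-1} − d_N(r,m)`. Then `m' ≤ m ≤ m' + 1`. -/
theorem sendwaste_at_most_one_round_later
    {n t : ℕ} (ht : t < n)
    (r' : Run (FIP n)) (hr' : r' ∈ Sys (FIP n) t)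
    (r : Run (sendE n)) (hr : r ∈ Sys (sendE n) t)
    (hcorr : Corresponds (sendE n) (FIP n) r r')
    (m' m : ℕ)
    (hm' : m' = min (t+1) (n-1) - Waste (FIP n) (Sys (FIP n) t) t r')
    (hm : min (t+1) (n-1) - dN r m ≤ m)
    (hmin : ∀ k, k < m → ¬ (min (t+1) (n-1) - dN r k ≤ k)) :
    m' ≤ m ∧ m ≤ m' + 1 := by
  have henv := hcorr.1
  have hub := dN_le_waste hr hr' henv m
  refine ⟨by omega, ?_⟩
  by_contra! hlt
  obtain ⟨k, hk⟩ := exists_waste_eq (FIP n) (Sys (FIP n) t) t r'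
  have hKt := (numKF_mem (FIP n) (Sys (FIP n) t) t r' k).1
  have hKf := numKF_le_numFailed (t := t) hr' k
  have hdec := hmin (m' + 1) hlt
  have hlow : k ≤ m' → numFailed r'.env k - (k + 1) ≤ dN r (m' + 1) := fun hkm => by
    rw [← henv]
    exact numFailed_sub_le_dN ht hr (by omega)
  omega

end SBA
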